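/- Let P be an n×n partial permutation matrix with exactly r entries equal to 1 (i.e. rank P = r). Then the Zariski closure of the stratum E_P = {(X,Y) ∈ Mₙ(ℂ)² : X ∈ B₊PB₊ and XY, YX are both upper triangular} has dimension n² + r; that is, the Krull dimension of R/𝕀(E_P) equals n² + r. -/

import Mathlib

noncomputable section

/-- Pairs of `n × n` complex matrices are points of `ℂ^{2n²}`. -/
abbrev MatC (n : ℕ) := Matrix (Fin n) (Fin n) ℂ

/-- The polynomial ring `R = ℂ[x_{ij}, y_{ij}]` in `2n²` variables. -/
abbrev PolyRing (n : ℕ) := MvPolynomial ((Fin n × Fin n) ⊕ (Fin n × Fin n)) ℂ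

/-- Evaluation of a polynomial at a point `(X, Y)` of `ℂ^{2n²}`. -/
def evalPt (n : ℕ) (p : MatC n × MatC n) : PolyRing n →+* ℂ :=
  MvPolynomial.eval (Sum.elim (fun q => p.1 q.1 q.2) (fun q => p.2 q.1 q.2))

/-- The vanishing ideal `𝕀(S)` of a subset `S ⊆ ℂ^{2n²}`. -/
def vanishingIdeal (n : ℕ) (S : Set (MatC n × MatC n)) : Ideal (PolyRing n) :=
  ⨅ p ∈ S, RingHom.ker (evalPt n p)

/-- `M` is upper triangular: `M_{ij} = 0` for `i > j`. -/
def IsUpperTri {n : ℕ} (M : MatC n) : Prop := ∀ i j : Fin n, j < i → M i j = 0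

/-- `P` is a partial permutation matrix: a 0,1-matrix with at most one 1 in
each row and column. -/
def IsPartialPermMat {n : ℕ} (P : MatC n) : Prop :=
  (∀ i j : Fin n, P i j = 0 ∨ P i j = 1) ∧
  (∀ i j k : Fin n, P i j = 1 → P i k = 1 → j = k) ∧
  (∀ i j k : Fin n, P i j = 1 → P k j = 1 → i = k)

/-- The stratum `E_P = {(X,Y) : X ∈ B₊PB₊, XY and YX upper triangular}`. -/
def EP {n : ℕ} (P : MatC n) : Set (MatC n × MatC n) :=
  { p | (∃ B₁ B₂ : MatC n, IsUnit B₁ ∧ IsUpperTri B₁ ∧ IsUnit B₂ ∧ IsUpperTri B₂ ∧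
          p.1 = B₁ * P * B₂) ∧
        IsUpperTri (p.1 * p.2) ∧ IsUpperTri (p.2 * p.1) }

lemma ringKrullDim_eq_of_isIntegral_of_injective {R S : Type*} [CommRing R] [CommRing S]
    [IsDomain S] [Algebra R S] [Algebra.IsIntegral R S]
    (hinj : Function.Injective (algebraMap R S)) :
    ringKrullDim S = ringKrullDim R := by
  apply le_antisymm
  · refine Order.krullDim_le_of_strictMono (PrimeSpectrum.comap (algebraMap R S)) ?_
    intro I J h
    exact Ideal.IsIntegral.comap_lt_comap (R := R) h
  · refine iSup_le fun l => ?_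
    obtain ⟨P, hP, hP'⟩ := Ideal.exists_ideal_over_prime_of_isIntegral_of_isDomain (S := S)
      l.head.asIdeal (by simp [(RingHom.injective_iff_ker_eq_bot _).mp hinj])
    have : P.LiesOver l.head.asIdeal := ⟨hP'.symm⟩
    obtain ⟨L, hL, -⟩ := Ideal.exists_ltSeries_of_hasGoingUp l P
    rw [← hL]
    exact le_iSup (fun p : LTSeries (PrimeSpectrum S) => (p.length : WithBot ℕ∞)) L

lemma ringKrullDim_eq_of_trdeg_eq {k A : Type*} [Field k] [CommRing A] [IsDomain A] [Algebra k A]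
    [Algebra.FiniteType k A] {d : ℕ} (h : Algebra.trdeg k A = d) : ringKrullDim A = d := by
  obtain ⟨s, g, hinj, h_integral⟩ := exists_integral_inj_algHom_of_fg k A
  algebraize [g.toRingHom]
  have : IsScalarTower k (MvPolynomial (Fin s) k) A := .of_algebraMap_eq fun x => (g.commutes x).symm
  have : FaithfulSMul (MvPolynomial (Fin s) k) A :=
    (faithfulSMul_iff_algebraMap_injective _ _).mpr hinj
  have hb := (IsTranscendenceBasis.mvPolynomial (Fin s) k).algebraMap_comp (A := A)
  have hs := hb.lift_cardinalMk_eq_trdeg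
  rw [h] at hs
  have hsd : s = d := by simpa using hs
  rw [ringKrullDim_eq_of_isIntegral_of_injective (R := MvPolynomial (Fin s) k) hinj]
  simp [hsd, ringKrullDim_eq_zero_of_field]

namespace MvPolynomial

lemma pderiv_aeval {R ι σ : Type*} [CommRing R] [Fintype ι] (f : ι → MvPolynomial σ R) (j : σ)
    (p : MvPolynomial ι R) :
    pderiv j (aeval f p) = ∑ i, aeval f (pderiv i p) * pderiv j (f i) := by
  classical
  induction p using MvPolynomial.induction_on with
  | C a => simp
  | add p q hp hq => simp only [map_add, hp, hq, add_mul, Finset.sum_add_distrib]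
  | mul_X p q h =>
    simp only [map_mul, aeval_X, Derivation.leibniz, h, smul_eq_mul, pderiv_X, map_add, add_mul,
      Finset.sum_add_distrib, Finset.mul_sum, Pi.single_apply]
    congr 1
    · rw [Finset.sum_eq_single q] <;> simp +contextual [eq_comm]
    · exact Finset.sum_congr rfl fun i _ => by ring

/-- The Jacobian criterion for algebraic independence. -/
lemma algebraicIndependent_of_jacobian {k ι σ : Type*} [Field k] [CharZero k] [Fintype ι]
    [DecidableEq ι] (f : ι → MvPolynomial σ k) (e : ι → σ) (z : σ → k)
    (h : ∀ s t, eval z (pderiv (e t) (f s)) = if s = t then 1 else 0) :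
    AlgebraicIndependent k f := by
  set J : Matrix ι ι (MvPolynomial σ k) := .of fun s t => pderiv (e t) (f s) with hJ
  have hdet : J.det ≠ 0 := by
    intro h0
    have : (J.map (eval z)).det = 0 := by
      rw [← RingHom.mapMatrix_apply, ← RingHom.map_det, h0, map_zero]
    have h1 : J.map (eval z) = 1 := by ext s t; simp [hJ, h, Matrix.one_apply]
    simp [h1] at this
  have key : ∀ (n : ℕ) (p : MvPolynomial ι k), (∀ m, coeff m p ≠ 0 → m.degree < n) →
      aeval f p = 0 → p = 0 := by
    intro n
    induction n with
    | zero => exact fun p hp _ => by ext m; by_contra hm; exact absurd (hp m hm) (by simp)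
    | succ n ih =>
      intro p hp hp0
      have hv : Matrix.vecMul (fun i => aeval f (pderiv i p)) J = 0 := by
        ext1 t
        have := pderiv_aeval f (e t) p
        rw [hp0, map_zero] at this
        exact this.symm
      have hd := Matrix.eq_zero_of_vecMul_eq_zero hdet hv
      have hpd : ∀ i, pderiv i p = 0 := by
        intro i
        refine ih _ (fun m hm => ?_) (congrFun hd i)
        rw [coeff_pderiv] at hm
        simpa using hp _ (left_ne_zero_of_mul hm)
      have hc : p = C (coeff 0 p) := by
        ext m
        by_cases hm : m = 0
        · simp [hm]
        · obtain ⟨i, hi⟩ := Finsupp.ne_iff.mp hm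
          have hle : Finsupp.single i 1 ≤ m := by
            simpa [Finsupp.single_le_iff, Nat.one_le_iff_ne_zero] using hi
          have h1 := coeff_pderiv (i := i) p (m - Finsupp.single i 1)
          rw [hpd, coeff_zero, tsub_add_cancel_of_le hle, eq_comm, mul_eq_zero] at h1
          rw [coeff_C, if_neg (Ne.symm hm)]
          exact h1.resolve_right (Nat.cast_add_one_ne_zero _)
      rw [hc, aeval_C, algebraMap_eq] at hp0
      rw [C_eq_zero] at hp0
      rw [hc, hp0, C_0]
  rw [algebraicIndependent_iff]
  intro p hp
  refine key (p.totalDegree + 1) p (fun m hm => ?_) hp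
  have := le_totalDegree (mem_support_iff.mpr hm)
  exact Nat.lt_succ_of_le this

end MvPolynomial

open scoped IntermediateField.algebraAdjoinAdjoin in
/-- A subalgebra of a field containing `d` algebraically independent elements, and contained in
the field which these generate, has transcendence degree `d`. -/
lemma trdeg_eq_card_of_le_adjoin {k K ι : Type*} [Field k] [Field K] [Algebra k K] [Fintype ι]
    (A : Subalgebra k K) (f : ι → K) (hf : AlgebraicIndependent k f) (hfA : ∀ i, f i ∈ A)
    (hA : ∀ a ∈ A, a ∈ IntermediateField.adjoin k (Set.range f)) :
    Algebra.trdeg k A = Fintype.card ι := by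
  apply le_antisymm
  · have h1 : Algebra.trdeg k A ≤ Algebra.trdeg k (IntermediateField.adjoin k (Set.range f)) :=
      trdeg_le_of_injective
        (Subalgebra.inclusion (S := A) (T := (IntermediateField.adjoin k (Set.range f)).toSubalgebra) hA)
        (Subalgebra.inclusion_injective _)
    refine h1.trans ?_
    have h2 := trdeg_add_eq k (Algebra.adjoin k (Set.range f))
      (A := IntermediateField.adjoin k (Set.range f))
    have h3 := hf.aevalEquiv.lift_trdeg_eq
    rw [← h2, trdeg_eq_zero (R := Algebra.adjoin k (Set.range f)), add_zero]
    simpa using h3.symm.le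
  · have hg : AlgebraicIndependent k (fun i => (⟨f i, hfA i⟩ : A)) :=
      AlgebraicIndependent.of_comp A.val hf
    have := hg.lift_cardinalMk_le_trdeg
    simpa using this

/-- Solutions of a uniquely solvable linear system over a subfield lie in this subfield. -/
lemma mem_of_mulVec_eq {K m : Type*} [Field K] [Fintype m] [DecidableEq m] (F : Subfield K)
    (A : Matrix m m K) (hA : A.det ≠ 0) (hAF : ∀ i j, A i j ∈ F) (v : m → K)
    (hv : ∀ i, A.mulVec v i ∈ F) (i : m) : v i ∈ F := by
  set A' : Matrix m m F := .of fun i j => ⟨A i j, hAF i j⟩ with hA'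
  set u' : m → F := fun i => ⟨A.mulVec v i, hv i⟩ with hu'
  have hmap : A'.map F.subtype = A := rfl
  have hdet : A'.det ≠ 0 := by
    intro h
    apply hA
    rw [← hmap, ← RingHom.mapMatrix_apply, ← RingHom.map_det, h, map_zero]
  have h1 : A'.mulVec (A'⁻¹.mulVec u') = u' := by
    rw [Matrix.mulVec_mulVec, Matrix.mul_nonsing_inv _ hdet.isUnit, Matrix.one_mulVec]
  have h2 : A.mulVec (fun i => F.subtype (A'⁻¹.mulVec u' i)) = A.mulVec v := by
    ext i
    have := congrArg F.subtype (congrFun h1 i)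
    rw [RingHom.map_mulVec] at this
    exact this
  have h3 := Matrix.mulVec_injective_of_isUnit ((Matrix.isUnit_iff_isUnit_det A).mpr hA.isUnit) h2
  rw [← h3]
  exact (A'⁻¹.mulVec u' i).2

/-- The positions `(a, c)` weakly above or weakly to the right of an entry `1` of `P`. -/
def tangentPos {n : ℕ} (P : Matrix (Fin n) (Fin n) ℂ) (a c : Fin n) : Prop :=
  (∃ i, P i c = 1 ∧ a ≤ i) ∨ ∃ j, P a j = 1 ∧ j ≤ c

/-- The positions `(a, c)` strictly above or strictly to the right of an entry `1` of `P`. -/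
def strictTangentPos {n : ℕ} (P : Matrix (Fin n) (Fin n) ℂ) (a c : Fin n) : Prop :=
  (∃ i, P i c = 1 ∧ a < i) ∨ ∃ j, P a j = 1 ∧ j < c

lemma mul_mul_apply_eq_sum_subtype {R : Type*} [CommRing R] [Algebra ℂ R] {n : ℕ}
    {P : Matrix (Fin n) (Fin n) ℂ} (h01 : ∀ i j, P i j = 0 ∨ P i j = 1)
    {U W : Matrix (Fin n) (Fin n) R} (hU : U.BlockTriangular id) (hW : W.BlockTriangular id)
    {a c e f : Fin n} (hae : a ≤ e) (hfc : f ≤ c) :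
    (U * P.map (algebraMap ℂ R) * W) e f =
      ∑ q : {q : Fin n × Fin n // P q.1 q.2 = 1 ∧ a ≤ q.1 ∧ q.2 ≤ c},
        U e q.1.1 * W q.1.2 f := by
  classical
  have h1 : (U * P.map (algebraMap ℂ R) * W) e f =
      ∑ q : Fin n × Fin n, U e q.1 * algebraMap ℂ R (P q.1 q.2) * W q.2 f := by
    simp only [Matrix.mul_apply, Finset.sum_mul, Matrix.map_apply]
    rw [Finset.sum_comm, ← Finset.univ_product_univ, Finset.sum_product]
  rw [h1, ← Finset.sum_subset (Finset.subset_univ (Finset.univ.filter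
    fun q : Fin n × Fin n => P q.1 q.2 = 1 ∧ a ≤ q.1 ∧ q.2 ≤ c))]
  · rw [Finset.sum_subtype _ (p := fun q : Fin n × Fin n => P q.1 q.2 = 1 ∧ a ≤ q.1 ∧ q.2 ≤ c)
      (by simp)]
    exact Finset.sum_congr rfl fun q _ => by simp [q.2.1]
  · intro q _ hq
    rcases h01 q.1 q.2 with h | h
    · simp [h]
    · simp only [Finset.mem_filter, Finset.mem_univ, true_and, not_and, h] at hq
      by_cases h2 : a ≤ q.1
      · rw [hW (show id f < id q.2 from hfc.trans_lt (not_le.mp (hq h2)))]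
        simp
      · rw [hU (show id q.1 < id e from (not_le.mp h2).trans_le hae)]
        simp

lemma det_ne_zero_of_blockTriangular {K m α : Type*} [Field K] [Fintype m] [DecidableEq m]
    [LinearOrder α] (M : Matrix m m K) (b : m → α) (hb : Function.Injective b)
    (hM : M.BlockTriangular b) (hd : ∀ i, M i i ≠ 0) : M.det ≠ 0 := by
  let _ := LinearOrder.lift' b hb
  have : M.BlockTriangular id := fun i j h => hM h
  rw [Matrix.det_of_isUpperTriangular this]
  exact Finset.prod_ne_zero_iff.mpr fun i _ => hd i

/-- All entries of `X ∈ B₊PB₊` lie in the field generated by the entries at tangent positions. -/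
lemma mem_of_tangentPos_mem {K : Type*} [Field K] [Algebra ℂ K] {n : ℕ}
    {P : Matrix (Fin n) (Fin n) ℂ} (h01 : ∀ i j, P i j = 0 ∨ P i j = 1)
    (hrow : ∀ i j k, P i j = 1 → P i k = 1 → j = k)
    (hcol : ∀ i j k, P i j = 1 → P k j = 1 → i = k)
    {U W : Matrix (Fin n) (Fin n) K} (hU : U.BlockTriangular id) (hW : W.BlockTriangular id)
    (hUd : ∀ i, U i i ≠ 0) (hWd : ∀ i, W i i ≠ 0) (F : Subfield K)
    (hF : ∀ a c, tangentPos P a c → (U * P.map (algebraMap ℂ K) * W) a c ∈ F) (a c : Fin n) :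
    (U * P.map (algebraMap ℂ K) * W) a c ∈ F := by
  classical
  induction h : n - (a : ℕ) + c using Nat.strong_induction_on generalizing a c with
  | _ N ih =>
  by_cases hac : tangentPos P a c
  · exact hF a c hac
  set X := U * P.map (algebraMap ℂ K) * W with hX
  let Q := {q : Fin n × Fin n // P q.1 q.2 = 1 ∧ a ≤ q.1 ∧ q.2 ≤ c}
  have hq1 : ∀ q : Q, a < q.1.1 := fun q => lt_of_le_of_ne q.2.2.1 fun h =>
    hac (Or.inr ⟨q.1.2, (congrArg (P · q.1.2) h).trans q.2.1, q.2.2.2⟩)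
  have hq2 : ∀ q : Q, q.1.2 < c := fun q => lt_of_le_of_ne q.2.2.2 fun h =>
    hac (Or.inl ⟨q.1.1, (congrArg (P q.1.1) h).symm.trans q.2.1, q.2.2.1⟩)
  let M : Matrix Q Q K := .of fun q q' => U q.1.1 q'.1.1
  let N : Matrix Q Q K := .of fun q q' => W q.1.2 q'.1.2
  let w : Q → K := fun q => W q.1.2 c
  have hXs : ∀ e f, a ≤ e → f ≤ c → X e f = ∑ q : Q, U e q.1.1 * W q.1.2 f :=
    fun e f he hf => mul_mul_apply_eq_sum_subtype h01 hU hW he hf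
  have hM : M.det ≠ 0 := det_ne_zero_of_blockTriangular M (fun q => q.1.1)
    (fun q q' (h : q.1.1 = q'.1.1) => Subtype.ext (Prod.ext h (hrow _ _ _ q.2.1 (h ▸ q'.2.1))))
    (fun q q' h => hU h) (fun q => hUd _)
  have hN : N.det ≠ 0 := det_ne_zero_of_blockTriangular N (fun q => q.1.2)
    (fun q q' (h : q.1.2 = q'.1.2) => Subtype.ext (Prod.ext (hcol _ _ _ q.2.1 (h ▸ q'.2.1)) h))
    (fun q q' h => hW h) (fun q => hWd _)
  have hMN : ∀ q q', (M * N) q q' = X q.1.1 q'.1.2 := fun q q' => by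
    rw [hXs _ _ (hq1 q).le (hq2 q').le]; rfl
  let v := N⁻¹.mulVec w
  have hNv : N.mulVec v = w := by
    rw [Matrix.mulVec_mulVec, Matrix.mul_nonsing_inv _ hN.isUnit, Matrix.one_mulVec]
  have hv : ∀ q, v q ∈ F := by
    refine mem_of_mulVec_eq F (M * N) (by simp [Matrix.det_mul, hM, hN]) (fun q q' => ?_) v
      (fun q => ?_)
    · rw [hMN]
      have := hq1 q
      have := hq2 q'
      exact ih _ (by omega) _ _ rfl
    · have : (M * N).mulVec v q = X q.1.1 c := by
        rw [← Matrix.mulVec_mulVec, hNv, hXs _ _ (hq1 q).le le_rfl]; rfl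
      rw [this]
      have := hq1 q
      exact ih _ (by omega) _ _ rfl
  have hXac : X a c = ∑ q : Q, X a q.1.2 * v q := by
    rw [hXs a c le_rfl le_rfl]
    have h1 : ∀ q : Q, W q.1.2 c = ∑ q' : Q, W q.1.2 q'.1.2 * v q' := fun q =>
      (congrFun hNv q).symm
    simp only [h1, Finset.mul_sum]
    rw [Finset.sum_comm]
    refine Finset.sum_congr rfl fun q' _ => ?_
    rw [hXs a _ le_rfl (hq2 q').le, Finset.sum_mul]
    exact Finset.sum_congr rfl fun q _ => by ring
  rw [hXac]
  refine sum_mem fun q _ => mul_mem ?_ (hv q)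
  have := hq2 q
  exact ih _ (by omega) _ _ rfl

lemma det_ne_zero_of_map_eq_one {R S m : Type*} [CommRing R] [CommRing S] [Nontrivial S]
    [Fintype m] [DecidableEq m] (φ : R →+* S) (A : Matrix m m R) (h : A.map φ = 1) :
    A.det ≠ 0 := by
  intro h0
  have : (A.map φ).det = 0 := by
    rw [← RingHom.mapMatrix_apply, ← RingHom.map_det, h0, map_zero]
  simp [h] at this

/-- If `XY` and `YX` are upper triangular and `X` specializes to `P`, then all entries of `Y` lie
in the field generated by the entries of `X` and those of `Yᵀ` off the strict tangent positions. -/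
lemma mem_of_not_strictTangentPos_mem {R K : Type*} [CommRing R] [Field K] {n : ℕ}
    {P : Matrix (Fin n) (Fin n) ℂ} (h01 : ∀ i j, P i j = 0 ∨ P i j = 1)
    (hrow : ∀ i j k, P i j = 1 → P i k = 1 → j = k)
    (hcol : ∀ i j k, P i j = 1 → P k j = 1 → i = k)
    (ev : R →+* ℂ) (φ : R →+* K) (hφ : Function.Injective φ) {X Y : Matrix (Fin n) (Fin n) R}
    (hX : ∀ i j, ev (X i j) = P i j) (hXY : ∀ i j, j < i → (X * Y) i j = 0)
    (hYX : ∀ i j, j < i → (Y * X) i j = 0) (F : Subfield K) (hFX : ∀ i j, φ (X i j) ∈ F)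
    (hFY : ∀ a c, ¬ strictTangentPos P a c → φ (Y c a) ∈ F) (a c : Fin n) :
    φ (Y c a) ∈ F := by
  classical
  by_cases hac : strictTangentPos P a c
  swap
  · exact hFY a c hac
  have hL : ∀ t : {t : Fin n × Fin n // strictTangentPos P t.1 t.2}, ∃ L : Fin n × Fin n → R,
      ∑ s, L s * Y s.2 s.1 = 0 ∧ (∀ s, φ (L s) ∈ F) ∧
        ∀ s, ev (L s) = if t.1 = s then 1 else 0 := by
    rintro ⟨⟨a, c⟩, ⟨i, hi, hai⟩ | ⟨j, hj, hjc⟩⟩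
    · refine ⟨fun s => if s.1 = a then X i s.2 else 0, ?_, fun s => ?_, fun s => ?_⟩
      · refine Eq.trans ?_ (hXY i a hai)
        rw [Matrix.mul_apply, ← Finset.univ_product_univ, Finset.sum_product,
          Finset.sum_eq_single a] <;> simp +contextual
      · dsimp only
        split_ifs <;> simp [hFX, zero_mem]
      · rcases s with ⟨a', c'⟩
        have h1 : P i c' = if c = c' then 1 else 0 := by
          split_ifs with h
          · exact h ▸ hi
          · exact (h01 i c').resolve_right fun h' => h (hrow _ _ _ hi h')
        by_cases h : a = a' <;> simp [h, hX, h1, eq_comm]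
    · refine ⟨fun s => if s.2 = c then X s.1 j else 0, ?_, fun s => ?_, fun s => ?_⟩
      · refine Eq.trans ?_ (hYX c j hjc)
        rw [Matrix.mul_apply, ← Finset.univ_product_univ, Finset.sum_product]
        exact Finset.sum_congr rfl fun i _ => by simp [mul_comm]
      · dsimp only
        split_ifs <;> simp [hFX, zero_mem]
      · rcases s with ⟨a', c'⟩
        have h1 : P a' j = if a = a' then 1 else 0 := by
          split_ifs with h
          · exact h ▸ hj
          · exact (h01 a' j).resolve_right fun h' => h (hcol _ _ _ hj h')
        by_cases h : c = c' <;> simp [h, hX, h1, eq_comm]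
  choose L hL0 hLF hLev using hL
  let T := {t : Fin n × Fin n // strictTangentPos P t.1 t.2}
  let A : Matrix T T R := .of fun t t' => L t t'.1
  have hA : A.det ≠ 0 := by
    refine det_ne_zero_of_map_eq_one ev A ?_
    ext t t'
    simp only [A, Matrix.map_apply, Matrix.of_apply, hLev, Matrix.one_apply]
    exact if_congr Subtype.ext_iff.symm rfl rfl
  have hA' : (A.map φ).det ≠ 0 := by
    rw [← RingHom.mapMatrix_apply, ← RingHom.map_det]
    exact (map_ne_zero_iff φ hφ).mpr hA
  refine mem_of_mulVec_eq F (A.map φ) hA' (fun t t' => hLF _ _) (fun t => φ (Y t.1.2 t.1.1))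
    (fun t => ?_) ⟨(a, c), hac⟩
  have h1 : (A.map φ).mulVec (fun t => φ (Y t.1.2 t.1.1)) t =
      - ∑ s : {s : Fin n × Fin n // ¬ strictTangentPos P s.1 s.2},
        φ (L t s.1) * φ (Y s.1.2 s.1.1) := by
    rw [eq_neg_iff_add_eq_zero, ← map_zero φ, ← hL0 t, map_sum]
    simp only [map_mul]
    exact Fintype.sum_subtype_add_sum_subtype (fun s : Fin n × Fin n => strictTangentPos P s.1 s.2)
      fun s => φ (L t s) * φ (Y s.2 s.1)
  rw [h1]
  exact neg_mem (sum_mem fun s _ => mul_mem (hLF _ _) (hFY _ _ s.2))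

lemma card_tangentPos {n : ℕ} {P : Matrix (Fin n) (Fin n) ℂ}
    (hrow : ∀ i j k, P i j = 1 → P i k = 1 → j = k)
    (hcol : ∀ i j k, P i j = 1 → P k j = 1 → i = k)
    [Fintype {s : Fin n × Fin n // tangentPos P s.1 s.2}]
    [Fintype {s : Fin n × Fin n // ¬ strictTangentPos P s.1 s.2}] :
    Fintype.card ({s : Fin n × Fin n // tangentPos P s.1 s.2} ⊕
      {s : Fin n × Fin n // ¬ strictTangentPos P s.1 s.2}) =
      n ^ 2 + (Finset.univ.filter fun q : Fin n × Fin n => P q.1 q.2 = 1).card := by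
  classical
  rw [Fintype.card_sum, Fintype.card_subtype, Fintype.card_subtype]
  have h1 : (Finset.univ.filter fun s : Fin n × Fin n => tangentPos P s.1 s.2) =
      (Finset.univ.filter fun s : Fin n × Fin n => strictTangentPos P s.1 s.2) ∪
        Finset.univ.filter fun s : Fin n × Fin n => P s.1 s.2 = 1 := by
    ext ⟨a, c⟩
    simp only [Finset.mem_filter, Finset.mem_univ, true_and, Finset.mem_union]
    simp only [tangentPos, strictTangentPos, le_iff_lt_or_eq]
    constructor
    · rintro (⟨i, h, h' | rfl⟩ | ⟨i, h, h' | rfl⟩)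
      exacts [.inl (.inl ⟨i, h, h'⟩), .inr h, .inl (.inr ⟨i, h, h'⟩), .inr h]
    · rintro ((⟨i, h, h'⟩ | ⟨i, h, h'⟩) | h)
      · exact .inl ⟨i, h, .inl h'⟩
      · exact .inr ⟨i, h, .inl h'⟩
      · exact .inl ⟨a, h, .inr rfl⟩
  have h2 : Disjoint (Finset.univ.filter fun s : Fin n × Fin n => strictTangentPos P s.1 s.2)
      (Finset.univ.filter fun s : Fin n × Fin n => P s.1 s.2 = 1) := by
    rw [Finset.disjoint_filter]
    rintro ⟨a, c⟩ - (⟨i, h, h'⟩ | ⟨i, h, h'⟩) h3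
    · exact h'.ne (hcol _ _ _ h3 h)
    · exact h'.ne (hrow _ _ _ h h3)
  have h3 := Finset.card_filter_add_card_filter_not (s := Finset.univ)
    (fun s : Fin n × Fin n => strictTangentPos P s.1 s.2)
  rw [h1, Finset.card_union_of_disjoint h2]
  simp only [Finset.card_univ, Fintype.card_prod, Fintype.card_fin] at h3
  rw [sq]
  omega

/-- The upper triangular matrix with entries `u`. -/
def upperMatrix {R : Type*} [Zero R] {n : ℕ} (u : Fin n × Fin n → R) : Matrix (Fin n) (Fin n) R :=
  .of fun i j => if i ≤ j then u (i, j) else 0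

open scoped Classical in
/-- The matrix `V` with entries `v`, except that its entries transposed to strict tangent positions
vanish; equivalently, the generic matrix such that `PV` and `VP` are upper triangular. -/
def conormalMatrix {R : Type*} [Zero R] {n : ℕ} (P : Matrix (Fin n) (Fin n) ℂ)
    (v : Fin n × Fin n → R) : Matrix (Fin n) (Fin n) R :=
  .of fun c a => if strictTangentPos P a c then 0 else v (c, a)

/-- The first component `B₁ P B₂` of the parametrization of `E_P`. -/
def paramX {R : Type*} [CommRing R] [Algebra ℂ R] {n : ℕ} (P : Matrix (Fin n) (Fin n) ℂ)
    (u : (Fin n × Fin n) ⊕ (Fin n × Fin n) ⊕ (Fin n × Fin n) → R) : Matrix (Fin n) (Fin n) R :=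
  upperMatrix (fun q => u (.inl q)) * P.map (algebraMap ℂ R) *
    upperMatrix (fun q => u (.inr (.inl q)))

/-- The second component `adj(B₂) V adj(B₁)` of the parametrization of `E_P`. -/
def paramY {R : Type*} [CommRing R] {n : ℕ} (P : Matrix (Fin n) (Fin n) ℂ)
    (u : (Fin n × Fin n) ⊕ (Fin n × Fin n) ⊕ (Fin n × Fin n) → R) : Matrix (Fin n) (Fin n) R :=
  (upperMatrix (fun q => u (.inr (.inl q)))).adjugate *
    conormalMatrix P (fun q => u (.inr (.inr q))) *
    (upperMatrix (fun q => u (.inl q))).adjugate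

lemma blockTriangular_upperMatrix {R : Type*} [Zero R] {n : ℕ} (u : Fin n × Fin n → R) :
    (upperMatrix u).BlockTriangular id :=
  fun _ _ h => if_neg (not_le.mpr h)

lemma map_upperMatrix {R S F : Type*} [Zero R] [Zero S] [FunLike F R S] [ZeroHomClass F R S]
    {n : ℕ} (f : F) (u : Fin n × Fin n → R) :
    (upperMatrix u).map f = upperMatrix fun q => f (u q) := by
  ext i j
  simp [upperMatrix, apply_ite f]

lemma map_conormalMatrix {R S F : Type*} [Zero R] [Zero S] [FunLike F R S] [ZeroHomClass F R S]
    {n : ℕ} (P : Matrix (Fin n) (Fin n) ℂ) (f : F) (u : Fin n × Fin n → R) :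
    (conormalMatrix P u).map f = conormalMatrix P fun q => f (u q) := by
  ext i j
  simp [conormalMatrix, apply_ite f]

lemma map_paramX {R S : Type*} [CommRing R] [CommRing S] [Algebra ℂ R] [Algebra ℂ S] {n : ℕ}
    (P : Matrix (Fin n) (Fin n) ℂ) (f : R →ₐ[ℂ] S)
    (u : (Fin n × Fin n) ⊕ (Fin n × Fin n) ⊕ (Fin n × Fin n) → R) :
    (paramX P u).map f = paramX P fun q => f (u q) := by
  have : (P.map (algebraMap ℂ R)).map f = P.map (algebraMap ℂ S) := by ext; simp
  rw [paramX, Matrix.map_mul, Matrix.map_mul, map_upperMatrix, map_upperMatrix, this, paramX]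

lemma map_paramY {R S : Type*} [CommRing R] [CommRing S] [Algebra ℂ R] [Algebra ℂ S] {n : ℕ}
    (P : Matrix (Fin n) (Fin n) ℂ) (f : R →ₐ[ℂ] S)
    (u : (Fin n × Fin n) ⊕ (Fin n × Fin n) ⊕ (Fin n × Fin n) → R) :
    (paramY P u).map f = paramY P fun q => f (u q) := by
  have h (A : Matrix (Fin n) (Fin n) R) : A.adjugate.map f = (A.map f).adjugate :=
    f.map_adjugate A
  rw [paramY, Matrix.map_mul, Matrix.map_mul, h, h, map_upperMatrix, map_upperMatrix,
    map_conormalMatrix, paramY]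

/-- The comorphism of the parametrization of `E_P`. -/
def paramHom {n : ℕ} (P : MatC n) :
    PolyRing n →ₐ[ℂ] MvPolynomial ((Fin n × Fin n) ⊕ (Fin n × Fin n) ⊕ (Fin n × Fin n)) ℂ :=
  MvPolynomial.aeval (Sum.elim (fun q => paramX P MvPolynomial.X q.1 q.2)
    fun q => paramY P MvPolynomial.X q.1 q.2)

lemma eval_paramHom {n : ℕ} (P : MatC n)
    (z : (Fin n × Fin n) ⊕ (Fin n × Fin n) ⊕ (Fin n × Fin n) → ℂ) (p : PolyRing n) :
    MvPolynomial.eval z (paramHom P p) = evalPt n (paramX P z, paramY P z) p := by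
  have hX (i j : Fin n) : MvPolynomial.aeval z (paramX P (MvPolynomial.X (R := ℂ)) i j) =
      paramX P z i j := by
    simpa using congrFun₂ (map_paramX P (MvPolynomial.aeval z) MvPolynomial.X) i j
  have hY (i j : Fin n) : MvPolynomial.aeval z (paramY P (MvPolynomial.X (R := ℂ)) i j) =
      paramY P z i j := by
    simpa using congrFun₂ (map_paramY P (MvPolynomial.aeval z) MvPolynomial.X) i j
  have : (MvPolynomial.aeval z).comp (paramHom P) = MvPolynomial.aeval (R := ℂ)
      (Sum.elim (fun q => paramX P z q.1 q.2) (fun q => paramY P z q.1 q.2)) := by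
    ext q
    rcases q with q | q <;> simp only [paramHom, AlgHom.comp_apply, MvPolynomial.aeval_X,
      Sum.elim_inl, Sum.elim_inr, hX, hY]
  exact DFunLike.congr_fun this p

lemma mem_vanishingIdeal {n : ℕ} {S : Set (MatC n × MatC n)} {p : PolyRing n} :
    p ∈ vanishingIdeal n S ↔ ∀ q ∈ S, evalPt n q p = 0 := by
  simp [vanishingIdeal, Submodule.mem_iInf, RingHom.mem_ker]

lemma IsUpperTri.mul {n : ℕ} {A B : MatC n} (hA : IsUpperTri A) (hB : IsUpperTri B) :
    IsUpperTri (A * B) := by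
  have hA' : A.BlockTriangular id := fun i j h => hA i j h
  have hB' : B.BlockTriangular id := fun i j h => hB i j h
  exact fun i j h => hA'.mul hB' h

lemma IsUpperTri.inv {n : ℕ} {A : MatC n} (hA : IsUpperTri A) : IsUpperTri A⁻¹ := by
  by_cases h : IsUnit A.det
  · have hA' : A.BlockTriangular id := fun i j h => hA i j h
    have := A.invertibleOfIsUnitDet h
    exact fun i j h => Matrix.blockTriangular_inv_of_blockTriangular hA' h
  · rw [Matrix.nonsing_inv_apply_not_isUnit _ h]
    exact fun _ _ _ => rfl

lemma IsUpperTri.smul {n : ℕ} {A : MatC n} (hA : IsUpperTri A) (c : ℂ) : IsUpperTri (c • A) :=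
  fun i j h => by simp [hA i j h]

lemma isUpperTri_mul_iff {n : ℕ} {P V : MatC n} (hP : IsPartialPermMat P) :
    IsUpperTri (P * V) ∧ IsUpperTri (V * P) ↔ ∀ a c, strictTangentPos P a c → V c a = 0 := by
  constructor
  · rintro ⟨h1, h2⟩ a c (⟨i, hi, hai⟩ | ⟨j, hj, hjc⟩)
    · rw [← h1 i a hai, Matrix.mul_apply, Finset.sum_eq_single c]
      · simp [hi]
      · intro b _ hb
        rw [(hP.1 i b).resolve_right fun h => hb (hP.2.1 _ _ _ h hi), zero_mul]
      · simp
    · rw [← h2 c j hjc, Matrix.mul_apply, Finset.sum_eq_single a]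
      · simp [hj]
      · intro b _ hb
        rw [(hP.1 b j).resolve_right fun h => hb (hP.2.2 _ _ _ h hj), mul_zero]
      · simp
  · intro h
    refine ⟨fun i a hai => Matrix.mul_apply.trans (Finset.sum_eq_zero fun c _ => ?_),
      fun c j hjc => Matrix.mul_apply.trans (Finset.sum_eq_zero fun a _ => ?_)⟩
    · rcases hP.1 i c with h1 | h1
      · simp [h1]
      · simp [h a c (.inl ⟨i, h1, hai⟩)]
    · rcases hP.1 a j with h1 | h1
      · simp [h1]
      · simp [h a c (.inr ⟨j, h1, hjc⟩)]

lemma param_mem_EP {n : ℕ} {P : MatC n} (hP : IsPartialPermMat P)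
    (z : (Fin n × Fin n) ⊕ (Fin n × Fin n) ⊕ (Fin n × Fin n) → ℂ)
    (h1 : (upperMatrix fun q => z (.inl q)).det ≠ 0)
    (h2 : (upperMatrix fun q => z (.inr (.inl q))).det ≠ 0) :
    (paramX P z, paramY P z) ∈ EP P := by
  have hmap : P.map (algebraMap ℂ ℂ) = P := by ext; simp
  have hV := (isUpperTri_mul_iff (V := conormalMatrix P fun q => z (.inr (.inr q))) hP).mpr
    fun a c h => by simp [conormalMatrix, h]
  have hB1 : IsUpperTri (upperMatrix fun q => z (.inl q)) :=
    fun i j h => blockTriangular_upperMatrix _ h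
  have hB2 : IsUpperTri (upperMatrix fun q => z (.inr (.inl q))) :=
    fun i j h => blockTriangular_upperMatrix _ h
  simp only [paramX, paramY, hmap]
  generalize (upperMatrix fun q => z (.inl q)) = B₁ at *
  generalize (upperMatrix fun q => z (.inr (.inl q))) = B₂ at *
  generalize (conormalMatrix P fun q => z (.inr (.inr q))) = V at *
  have hadj (A : MatC n) (hA : IsUpperTri A) (hd : A.det ≠ 0) : IsUpperTri A.adjugate := by
    have := hA.inv.smul A.det
    rwa [Matrix.inv_def, smul_smul, Ring.mul_inverse_cancel _ hd.isUnit, one_smul] at this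
  refine ⟨⟨B₁, B₂, B₁.isUnit_iff_isUnit_det.mpr h1.isUnit, hB1,
    B₂.isUnit_iff_isUnit_det.mpr h2.isUnit, hB2, rfl⟩, ?_, ?_⟩
  · have : B₁ * P * B₂ * (B₂.adjugate * V * B₁.adjugate) =
        B₂.det • (B₁ * (P * V) * B₁.adjugate) := by
      calc _ = B₁ * P * (B₂ * B₂.adjugate) * V * B₁.adjugate := by simp only [mul_assoc]
        _ = _ := by simp [Matrix.mul_adjugate, mul_assoc]
    rw [this]
    exact ((hB1.mul hV.1).mul (hadj _ hB1 h1)).smul _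
  · have : B₂.adjugate * V * B₁.adjugate * (B₁ * P * B₂) =
        B₁.det • (B₂.adjugate * (V * P) * B₂) := by
      calc _ = B₂.adjugate * V * (B₁.adjugate * B₁) * P * B₂ := by simp only [mul_assoc]
        _ = _ := by simp [Matrix.adjugate_mul, mul_assoc]
    rw [this]
    exact (((hadj _ hB2 h2).mul hV.2).mul hB2).smul _

lemma exists_param_of_mem_EP {n : ℕ} {P : MatC n} (hP : IsPartialPermMat P) {p : MatC n × MatC n}
    (hp : p ∈ EP P) : ∃ z, p = (paramX P z, paramY P z) := by
  obtain ⟨X, Y⟩ := p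
  obtain ⟨⟨B₁, B₂, h1, hB1, h2, hB2, rfl : X = _⟩, hXY, hYX⟩ := hp
  dsimp only at hXY hYX
  have hmap : P.map (algebraMap ℂ ℂ) = P := by ext; simp
  have h1' := B₁.isUnit_iff_isUnit_det.mp h1
  have h2' := B₂.isUnit_iff_isUnit_det.mp h2
  set V : MatC n := (B₁.det * B₂.det)⁻¹ • (B₂ * Y * B₁) with hV
  have hVP : ∀ a c, strictTangentPos P a c → V c a = 0 := by
    rw [← isUpperTri_mul_iff hP]
    constructor
    · have : P * V = (B₁.det * B₂.det)⁻¹ • (B₁⁻¹ * (B₁ * P * B₂ * Y) * B₁) := by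
        rw [hV, Matrix.mul_smul]
        congr 1
        calc _ = (B₁⁻¹ * B₁) * P * B₂ * Y * B₁ := by
              rw [Matrix.nonsing_inv_mul _ h1']; simp only [mul_assoc, one_mul]
          _ = _ := by simp only [mul_assoc]
      rw [this]
      exact ((hB1.inv.mul hXY).mul hB1).smul _
    · have : V * P = (B₁.det * B₂.det)⁻¹ • (B₂ * (Y * (B₁ * P * B₂)) * B₂⁻¹) := by
        rw [hV, Matrix.smul_mul]
        congr 1
        calc _ = B₂ * Y * B₁ * P * (B₂ * B₂⁻¹) := by
              rw [Matrix.mul_nonsing_inv _ h2', mul_one]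
          _ = _ := by simp only [mul_assoc]
      rw [this]
      exact ((hB2.mul hYX).mul hB2.inv).smul _
  have hupper (B : MatC n) (hB : IsUpperTri B) : upperMatrix (fun q => B q.1 q.2) = B := by
    ext i j
    by_cases h : i ≤ j
    · simp [upperMatrix, h]
    · simp [upperMatrix, h, hB i j (not_le.mp h)]
  have hcon : conormalMatrix P (fun q => V q.1 q.2) = V := by
    ext c a
    by_cases h : strictTangentPos P a c
    · simp [conormalMatrix, h, hVP a c h]
    · simp [conormalMatrix, h]
  refine ⟨Sum.elim (fun q => B₁ q.1 q.2) (Sum.elim (fun q => B₂ q.1 q.2) fun q => V q.1 q.2), ?_⟩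
  simp only [paramX, paramY, Sum.elim_inl, Sum.elim_inr, hupper _ hB1, hupper _ hB2, hcon, hmap]
  congr 1
  calc Y = ((B₁.det * B₂.det)⁻¹ * (B₁.det * B₂.det)) • Y := by
        rw [inv_mul_cancel₀ (mul_ne_zero h1'.ne_zero h2'.ne_zero), one_smul]
    _ = (B₁.det * B₂.det)⁻¹ • ((B₂.adjugate * B₂) * Y * (B₁ * B₁.adjugate)) := by
        simp [Matrix.adjugate_mul, Matrix.mul_adjugate, smul_smul, mul_assoc]
    _ = _ := by simp only [hV, Matrix.mul_smul, Matrix.smul_mul, mul_assoc]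

lemma det_upperMatrix_X_ne_zero {n : ℕ} {σ : Type*} (v : Fin n × Fin n → σ) :
    (upperMatrix fun q => (MvPolynomial.X (v q) : MvPolynomial σ ℂ)).det ≠ 0 := by
  rw [Matrix.det_of_isUpperTriangular (blockTriangular_upperMatrix _)]
  exact Finset.prod_ne_zero_iff.mpr fun i _ => by simp [upperMatrix]

lemma vanishingIdeal_EP {n : ℕ} {P : MatC n} (hP : IsPartialPermMat P) :
    vanishingIdeal n (EP P) = RingHom.ker (paramHom P) := by
  ext p
  rw [mem_vanishingIdeal, RingHom.mem_ker]
  constructor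
  · intro h
    have h0 : (upperMatrix fun q => MvPolynomial.X (.inl q)).det *
        (upperMatrix fun q => MvPolynomial.X (.inr (.inl q))).det * paramHom P p = 0 := by
      refine MvPolynomial.funext fun z => ?_
      have hdet (v : Fin n × Fin n → (Fin n × Fin n) ⊕ (Fin n × Fin n) ⊕ (Fin n × Fin n)) :
          MvPolynomial.eval z (upperMatrix fun q => MvPolynomial.X (v q)).det =
            (upperMatrix fun q => z (v q)).det := by
        rw [RingHom.map_det, RingHom.mapMatrix_apply, map_upperMatrix]
        simp
      rw [map_mul, map_mul, hdet, hdet, eval_paramHom, map_zero]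
      by_cases h1 : (upperMatrix fun q => z (.inl q)).det = 0
      · simp [h1]
      by_cases h2 : (upperMatrix fun q => z (.inr (.inl q))).det = 0
      · simp [h2]
      rw [h _ (param_mem_EP hP z h1 h2), mul_zero]
    exact (mul_eq_zero.mp h0).resolve_left
      (mul_ne_zero (det_upperMatrix_X_ne_zero _) (det_upperMatrix_X_ne_zero _))
  · intro h q hq
    obtain ⟨z, rfl⟩ := exists_param_of_mem_EP hP hq
    rw [← eval_paramHom, h, map_zero]

lemma Derivation.map_matrix_mul {k R m : Type*} [CommRing k] [CommRing R] [Algebra k R] [Fintype m]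
    (D : Derivation k R R) (A B : Matrix m m R) :
    (A * B).map D = A.map D * B + A * B.map D := by
  ext i j
  simp only [Matrix.map_apply, Matrix.mul_apply, Matrix.add_apply, map_sum, Derivation.leibniz,
    smul_eq_mul, ← Finset.sum_add_distrib]
  exact Finset.sum_congr rfl fun k _ => by ring

/-- The parameters `B₁ = B₂ = 1`, `V = 0`, which map to the point `(P, 0)` of `E_P`. -/
def basePoint (n : ℕ) : (Fin n × Fin n) ⊕ (Fin n × Fin n) ⊕ (Fin n × Fin n) → ℂ :=
  Sum.elim (fun q => if q.1 = q.2 then 1 else 0)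
    (Sum.elim (fun q => if q.1 = q.2 then 1 else 0) 0)

lemma upperMatrix_ite_eq_one {n : ℕ} :
    upperMatrix (fun q : Fin n × Fin n => if q.1 = q.2 then (1 : ℂ) else 0) = 1 := by
  ext i j
  by_cases h : i = j <;> simp [upperMatrix, Matrix.one_apply, h]

lemma paramX_basePoint {n : ℕ} (P : MatC n) : paramX P (basePoint n) = P := by
  simp [paramX, basePoint, upperMatrix_ite_eq_one]

lemma eval_pderiv_paramX {n : ℕ} (P : MatC n)
    (t : (Fin n × Fin n) ⊕ (Fin n × Fin n) ⊕ (Fin n × Fin n)) (a c : Fin n) :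
    MvPolynomial.eval (basePoint n) (MvPolynomial.pderiv t (paramX P MvPolynomial.X a c)) =
      (∑ i, upperMatrix (fun q => if Sum.inl q = t then (1 : ℂ) else 0) a i * P i c) +
      ∑ k, P a k * upperMatrix (fun q => if Sum.inr (Sum.inl q) = t then (1 : ℂ) else 0) k c := by
  classical
  set D := MvPolynomial.pderiv (R := ℂ) t
  set ev := MvPolynomial.eval (basePoint n)
  have hP : (P.map (algebraMap ℂ (MvPolynomial _ ℂ))).map D = 0 := by ext; simp [D]
  have hP' : (P.map (algebraMap ℂ (MvPolynomial _ ℂ))).map ev = P := by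
    ext; simp [ev]
  change ((paramX P MvPolynomial.X).map D).map ev a c = _
  simp only [paramX, Derivation.map_matrix_mul, hP, mul_zero, add_zero, Matrix.map_add _ (map_add ev),
    Matrix.map_mul, map_upperMatrix, hP']
  have h1 : (fun q => ev (MvPolynomial.X (.inl q))) = fun q => if q.1 = q.2 then (1 : ℂ) else 0 := by
    ext q; simp [ev, basePoint]
  have h2 : (fun q => ev (MvPolynomial.X (.inr (.inl q)))) =
      fun q => if q.1 = q.2 then (1 : ℂ) else 0 := by
    ext q; simp [ev, basePoint]
  rw [h1, h2, upperMatrix_ite_eq_one, one_mul, mul_one]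
  simp [Matrix.add_apply, Matrix.mul_apply, D, ev, MvPolynomial.pderiv_X, Pi.single_apply,
    apply_ite (MvPolynomial.eval (basePoint n))]

lemma eval_pderiv_paramY {n : ℕ} (P : MatC n)
    (t : (Fin n × Fin n) ⊕ (Fin n × Fin n) ⊕ (Fin n × Fin n)) (c a : Fin n) :
    MvPolynomial.eval (basePoint n) (MvPolynomial.pderiv t (paramY P MvPolynomial.X c a)) =
      conormalMatrix P (fun q => if Sum.inr (Sum.inr q) = t then (1 : ℂ) else 0) c a := by
  classical
  set D := MvPolynomial.pderiv (R := ℂ) t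
  set ev := MvPolynomial.eval (basePoint n)
  have hadj (A : Matrix (Fin n) (Fin n) (MvPolynomial _ ℂ)) :
      A.adjugate.map ev = (A.map ev).adjugate := ev.map_adjugate A
  change ((paramY P MvPolynomial.X).map D).map ev c a = _
  simp only [paramY, Derivation.map_matrix_mul, Matrix.map_add _ (map_add ev),
    Matrix.map_mul, map_upperMatrix, map_conormalMatrix, hadj]
  have h1 : (fun q => ev (MvPolynomial.X (.inl q))) = fun q => if q.1 = q.2 then (1 : ℂ) else 0 := by
    ext q; simp [ev, basePoint]
  have h2 : (fun q => ev (MvPolynomial.X (.inr (.inl q)))) =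
      fun q => if q.1 = q.2 then (1 : ℂ) else 0 := by
    ext q; simp [ev, basePoint]
  have h3 : conormalMatrix P (fun q => ev (MvPolynomial.X (.inr (.inr q)))) = 0 := by
    ext i j; simp [ev, basePoint, conormalMatrix]
  rw [h1, h2, h3, upperMatrix_ite_eq_one, Matrix.adjugate_one, one_mul, mul_one, mul_zero, one_mul,
    zero_mul, zero_add, add_zero]
  simp [D, ev, MvPolynomial.pderiv_X, Pi.single_apply, apply_ite (MvPolynomial.eval (basePoint n))]

/-- The coordinates of the parametrization which form a transcendence basis. -/
def basisCoord {n : ℕ} (P : MatC n) :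
    {s : Fin n × Fin n // tangentPos P s.1 s.2} ⊕ {s : Fin n × Fin n // ¬ strictTangentPos P s.1 s.2} →
      MvPolynomial ((Fin n × Fin n) ⊕ (Fin n × Fin n) ⊕ (Fin n × Fin n)) ℂ :=
  Sum.elim (fun s => paramX P MvPolynomial.X s.1.1 s.1.2)
    fun s => paramY P MvPolynomial.X s.1.2 s.1.1

open scoped Classical in
lemma algebraicIndependent_basisCoord {n : ℕ} {P : MatC n} (hP : IsPartialPermMat P) :
    AlgebraicIndependent ℂ (basisCoord P) := by
  have hrow {i j : Fin n} (h : P i j = 1) (k : Fin n) : P i k = if j = k then 1 else 0 := by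
    split_ifs with h'
    · exact h' ▸ h
    · exact (hP.1 i k).resolve_right fun h'' => h' (hP.2.1 _ _ _ h h'')
  have hcol {i j : Fin n} (h : P i j = 1) (k : Fin n) : P k j = if i = k then 1 else 0 := by
    split_ifs with h'
    · exact h' ▸ h
    · exact (hP.1 k j).resolve_right fun h'' => h' (hP.2.2 _ _ _ h h'')
  have he : ∀ t : {s : Fin n × Fin n // tangentPos P s.1 s.2},
      ∃ x : (Fin n × Fin n) ⊕ (Fin n × Fin n) ⊕ (Fin n × Fin n),
        (∃ i, x = .inl (t.1.1, i) ∧ P i t.1.2 = 1 ∧ t.1.1 ≤ i) ∨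
          ∃ j, x = .inr (.inl (j, t.1.2)) ∧ P t.1.1 j = 1 ∧ j ≤ t.1.2 := by
    rintro ⟨s, ⟨i, h⟩ | ⟨j, h⟩⟩
    exacts [⟨_, .inl ⟨i, rfl, h⟩⟩, ⟨_, .inr ⟨j, rfl, h⟩⟩]
  choose e he using he
  refine MvPolynomial.algebraicIndependent_of_jacobian _
    (Sum.elim e fun t => .inr (.inr (t.1.2, t.1.1))) (basePoint n) ?_
  rintro (⟨⟨a, c⟩, hs⟩ | ⟨⟨a, c⟩, hs⟩) (t | t)
  · simp only [basisCoord, Sum.elim_inl, eval_pderiv_paramX, Sum.inl.injEq]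
    obtain ⟨i, hx, hi, hle⟩ | ⟨j, hx, hj, hle⟩ := he t <;> obtain ⟨⟨a', c'⟩, ht⟩ := t <;>
      dsimp only at *
    · rw [hx, Finset.sum_eq_single i, Finset.sum_eq_zero, add_zero, hrow hi]
      · by_cases h : a = a' <;> by_cases h' : c = c' <;>
          simp [upperMatrix, h, h', hle, eq_comm]
      · simp [upperMatrix]
      · intro b _ hb
        simp [upperMatrix, hb]
      · simp
    · rw [hx, Finset.sum_eq_zero, Finset.sum_eq_single j, zero_add, hcol hj]
      · by_cases h : a = a' <;> by_cases h' : c = c' <;>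
          simp [upperMatrix, h, h', hle, eq_comm]
      · intro b _ hb
        simp [upperMatrix, hb]
      · simp
      · simp [upperMatrix]
  · simp [basisCoord, eval_pderiv_paramX, upperMatrix]
  · simp only [basisCoord, Sum.elim_inl, Sum.elim_inr, eval_pderiv_paramY]
    obtain ⟨i, hx, -⟩ | ⟨j, hx, -⟩ := he t <;> simp [hx, conormalMatrix]
  · obtain ⟨⟨a', c'⟩, ht⟩ := t
    simp [basisCoord, eval_pderiv_paramY, conormalMatrix, hs, and_comm]

/-- The composition of `paramHom` with the inclusion of the polynomial ring in its fraction field. -/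
def paramHomFrac {n : ℕ} (P : MatC n) : PolyRing n →ₐ[ℂ]
    FractionRing (MvPolynomial ((Fin n × Fin n) ⊕ (Fin n × Fin n) ⊕ (Fin n × Fin n)) ℂ) :=
  (IsScalarTower.toAlgHom ℂ _ _).comp (paramHom P)

lemma ker_paramHomFrac {n : ℕ} (P : MatC n) :
    RingHom.ker (paramHomFrac P) = RingHom.ker (paramHom P) := by
  ext p
  simp [RingHom.mem_ker, paramHomFrac]

lemma paramX_mul_paramY_apply_eq_zero {n : ℕ} {P : MatC n} (hP : IsPartialPermMat P) (i j : Fin n)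
    (hij : j < i) :
    (paramX P MvPolynomial.X * paramY P MvPolynomial.X : Matrix _ _ (MvPolynomial _ ℂ)) i j = 0 ∧
      (paramY P MvPolynomial.X * paramX P MvPolynomial.X : Matrix _ _ (MvPolynomial _ ℂ)) i j = 0 := by
  have hker {p : PolyRing n} (hp : ∀ q ∈ EP P, evalPt n q p = 0) : paramHom P p = 0 := by
    rwa [← RingHom.mem_ker, ← vanishingIdeal_EP hP, mem_vanishingIdeal]
  have h1 := hker (p := ∑ k, MvPolynomial.X (.inl (i, k)) * MvPolynomial.X (.inr (k, j)))
    fun q hq => by simpa [evalPt, Matrix.mul_apply] using hq.2.1 i j hij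
  have h2 := hker (p := ∑ k, MvPolynomial.X (.inr (i, k)) * MvPolynomial.X (.inl (k, j)))
    fun q hq => by simpa [evalPt, Matrix.mul_apply] using hq.2.2 i j hij
  simp only [paramHom, map_sum, map_mul, MvPolynomial.aeval_X, Sum.elim_inl, Sum.elim_inr] at h1 h2
  exact ⟨h1, h2⟩

lemma paramHomFrac_mem_adjoin {n : ℕ} {P : MatC n} (hP : IsPartialPermMat P) (p : PolyRing n) :
    paramHomFrac P p ∈ IntermediateField.adjoin ℂ (Set.range fun s => algebraMap _
      (FractionRing (MvPolynomial ((Fin n × Fin n) ⊕ (Fin n × Fin n) ⊕ (Fin n × Fin n)) ℂ))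
      (basisCoord P s)) := by
  set K := FractionRing (MvPolynomial ((Fin n × Fin n) ⊕ (Fin n × Fin n) ⊕ (Fin n × Fin n)) ℂ)
  set F := IntermediateField.adjoin ℂ (Set.range fun s => algebraMap _ K (basisCoord P s)) with hF
  have hbasis (s) : algebraMap _ K (basisCoord P s) ∈ F :=
    IntermediateField.subset_adjoin _ _ ⟨s, rfl⟩
  have hmapX (a c) : algebraMap _ K (paramX P (MvPolynomial.X (R := ℂ)) a c) =
      paramX P (fun q => algebraMap _ K (MvPolynomial.X (R := ℂ) q)) a c :=
    congrFun₂ (map_paramX P (IsScalarTower.toAlgHom ℂ (MvPolynomial _ ℂ) K) MvPolynomial.X) a c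
  have hdiag (v : Fin n × Fin n → (Fin n × Fin n) ⊕ (Fin n × Fin n) ⊕ (Fin n × Fin n)) (i : Fin n) :
      upperMatrix (fun q => algebraMap _ K (MvPolynomial.X (R := ℂ) (v q))) i i ≠ 0 := by
    simp [upperMatrix]
  have hX (a c) : algebraMap _ K (paramX P (MvPolynomial.X (R := ℂ)) a c) ∈ F := by
    rw [hmapX]
    exact mem_of_tangentPos_mem hP.1 hP.2.1 hP.2.2 (blockTriangular_upperMatrix _)
      (blockTriangular_upperMatrix _) (hdiag Sum.inl) (hdiag (Sum.inr ∘ Sum.inl)) F.toSubfield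
      (fun a c hac => (congrArg (· ∈ F) (hmapX a c)).mp (hbasis (.inl ⟨(a, c), hac⟩))) a c
  have hY (a c) : algebraMap _ K (paramY P (MvPolynomial.X (R := ℂ)) c a) ∈ F :=
    mem_of_not_strictTangentPos_mem hP.1 hP.2.1 hP.2.2 (MvPolynomial.eval (basePoint n))
      (algebraMap _ K) (IsFractionRing.injective _ K)
      (fun i j => by
        have := map_paramX P (MvPolynomial.aeval (R := ℂ) (basePoint n)) MvPolynomial.X
        simp only [MvPolynomial.aeval_X, paramX_basePoint] at this
        exact congrFun₂ this i j)
      (fun i j h => (paramX_mul_paramY_apply_eq_zero hP i j h).1)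
      (fun i j h => (paramX_mul_paramY_apply_eq_zero hP i j h).2) F.toSubfield hX
      (fun a c hac => hbasis (.inr ⟨(a, c), hac⟩)) a c
  induction p using MvPolynomial.induction_on with
  | C a => exact AlgHom.commutes (paramHomFrac P) a ▸ F.algebraMap_mem a
  | add p q hp hq => exact map_add (paramHomFrac P) p q ▸ add_mem hp hq
  | mul_X p q hp =>
    rw [map_mul]
    refine mul_mem hp ?_
    rcases q with q | q
    · simpa [paramHomFrac, paramHom] using hX q.1 q.2
    · simpa [paramHomFrac, paramHom] using hY q.2 q.1

/-- For a partial permutation matrix `P` of rank `r` (with exactly `r` entries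
equal to 1), the Zariski closure of `E_P` has dimension `n² + r`: the Krull
dimension of `R/𝕀(E_P)` is `n² + r`. -/
theorem stmt19 (n : ℕ) (hn : 1 ≤ n) (P : MatC n) (hP : IsPartialPermMat P)
    (r : ℕ)
    (hr : (Finset.univ.filter fun q : Fin n × Fin n => P q.1 q.2 = 1).card = r) :
    ringKrullDim (PolyRing n ⧸ vanishingIdeal n (EP P)) = (n ^ 2 + r : ℕ) := by
  classical
  rw [vanishingIdeal_EP hP, ← ker_paramHomFrac,
    ringKrullDim_eq_of_ringEquiv (Ideal.quotientKerEquivRange (paramHomFrac P)).toRingEquiv]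
  have : Algebra.FiniteType ℂ (paramHomFrac P).range :=
    .of_surjective (paramHomFrac P).rangeRestrict (paramHomFrac P).rangeRestrict_surjective
  have hind : AlgebraicIndependent ℂ fun s => algebraMap _ (FractionRing
      (MvPolynomial ((Fin n × Fin n) ⊕ (Fin n × Fin n) ⊕ (Fin n × Fin n)) ℂ)) (basisCoord P s) :=
    (algebraicIndependent_basisCoord hP).map' (f := IsScalarTower.toAlgHom ℂ _ _)
      (IsFractionRing.injective _ _)
  apply ringKrullDim_eq_of_trdeg_eq (k := ℂ)
  rw [trdeg_eq_card_of_le_adjoin _ _ hind, card_tangentPos hP.2.1 hP.2.2, ← hr]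
  · rintro (s | s)
    · exact ⟨MvPolynomial.X (.inl s.1), by simp [paramHomFrac, paramHom, basisCoord]⟩
    · exact ⟨MvPolynomial.X (.inr (s.1.2, s.1.1)), by simp [paramHomFrac, paramHom, basisCoord]⟩
  · rintro _ ⟨p, rfl⟩
    exact paramHomFrac_mem_adjoin hP p
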